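/- For all terms t, t' in T_n^{*,∘}, one has t =_ALD t' if and only if I(t) = I(t'), the sequences J(t) and J(t') have the same length, and J(t)_k =_LD J(t')_k for every index k. (This reduces the word problem of the ALD laws to that of the LD law.) -/

import Mathlib

/-- Terms in `n` variables over two binary operation symbols `*` and `∘`. -/
inductive ALDTerm (n : ℕ) : Type
  | var : Fin n → ALDTerm n
  | star : ALDTerm n → ALDTerm n → ALDTerm n
  | circ : ALDTerm n → ALDTerm n → ALDTerm n

/-- The smallest congruence on terms containing all instances of (LD), (ALD₁), (ALD₂). -/
inductive ALDCong {n : ℕ} : ALDTerm n → ALDTerm n → Prop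
  | LD (t₁ t₂ t₃ : ALDTerm n) :
      ALDCong (.star t₁ (.star t₂ t₃)) (.star (.star t₁ t₂) (.star t₁ t₃))
  | ALD1 (t₁ t₂ t₃ : ALDTerm n) :
      ALDCong (.star (.circ t₁ t₂) t₃) (.star t₁ (.star t₂ t₃))
  | ALD2 (t₁ t₂ t₃ : ALDTerm n) :
      ALDCong (.star t₁ (.circ t₂ t₃)) (.circ (.star t₁ t₂) (.star t₁ t₃))
  | refl (t : ALDTerm n) : ALDCong t t
  | symm {s t : ALDTerm n} : ALDCong s t → ALDCong t s
  | trans {s t u : ALDTerm n} : ALDCong s t → ALDCong t u → ALDCong s u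
  | starCong {s s' t t' : ALDTerm n} : ALDCong s s' → ALDCong t t' →
      ALDCong (.star s t) (.star s' t')
  | circCong {s s' t t' : ALDTerm n} : ALDCong s s' → ALDCong t t' →
      ALDCong (.circ s t) (.circ s' t')

/-- Terms in `n` variables over the single operation symbol `*`. -/
inductive STerm (n : ℕ) : Type
  | var : Fin n → STerm n
  | star : STerm n → STerm n → STerm n

/-- The smallest congruence on `*`-terms containing all instances of (LD). -/
inductive LDCong {n : ℕ} : STerm n → STerm n → Prop
  | LD (t₁ t₂ t₃ : STerm n) :
      LDCong (.star t₁ (.star t₂ t₃)) (.star (.star t₁ t₂) (.star t₁ t₃))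
  | refl (t : STerm n) : LDCong t t
  | symm {s t : STerm n} : LDCong s t → LDCong t s
  | trans {s t u : STerm n} : LDCong s t → LDCong t u → LDCong s u
  | starCong {s s' t t' : STerm n} : LDCong s s' → LDCong t t' →
      LDCong (.star s t) (.star s' t')

/-- Terms in a single variable over the single operation symbol `∘`. -/
inductive CTerm : Type
  | var : CTerm
  | circ : CTerm → CTerm → CTerm

/-- The operation `⃗s ⃗* ⃗t`: the sequence of the same length as `⃗t` whose `j`-th
entry is `s₁*(s₂*(⋯*(s_p*t_j)⋯))`. -/
def vstar {n : ℕ} (s t : List (STerm n)) : List (STerm n) :=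
  t.map fun x => s.foldr STerm.star x

/-- The invariant `I(t)`, a `∘`-term in one variable. -/
def ITerm {n : ℕ} : ALDTerm n → CTerm
  | .var _ => .var
  | .star _ t₂ => ITerm t₂
  | .circ t₁ t₂ => .circ (ITerm t₁) (ITerm t₂)

/-- The invariant `J(t)`, a nonempty finite sequence of `*`-terms. -/
def JTerm {n : ℕ} : ALDTerm n → List (STerm n)
  | .var i => [.var i]
  | .star t₁ t₂ => vstar (JTerm t₁) (JTerm t₂)
  | .circ t₁ t₂ => JTerm t₁ ++ JTerm t₂


theorem LDCong.foldr_congr {n : ℕ} {l m : List (STerm n)} (h : List.Forall₂ LDCong l m)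
    {x y : STerm n} (hxy : LDCong x y) :
    LDCong (l.foldr STerm.star x) (m.foldr STerm.star y) := by
  induction h with
  | nil => exact hxy
  | cons hab _ ih => exact hab.starCong ih

theorem LDCong.foldr_star {n : ℕ} (l : List (STerm n)) (x y : STerm n) :
    LDCong (l.foldr STerm.star (x.star y))
      ((l.foldr STerm.star x).star (l.foldr STerm.star y)) := by
  induction l with
  | nil => exact .refl _
  | cons a l ih => exact ((LDCong.refl a).starCong ih).trans (.LD _ _ _)

theorem LDCong.foldr_foldr {n : ℕ} (l m : List (STerm n)) (x : STerm n) :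
    LDCong (l.foldr STerm.star (m.foldr STerm.star x))
      ((vstar l m).foldr STerm.star (l.foldr STerm.star x)) := by
  induction m with
  | nil => exact .refl _
  | cons a m ih => exact (LDCong.foldr_star l _ _).trans ((LDCong.refl _).starCong ih)

theorem ALDCong.iTerm_eq {n : ℕ} {t t' : ALDTerm n} (h : ALDCong t t') :
    ITerm t = ITerm t' := by
  induction h <;> simp_all [ITerm]

theorem ALDCong.jTerm_forall₂ {n : ℕ} {t t' : ALDTerm n} (h : ALDCong t t') :
    List.Forall₂ LDCong (JTerm t) (JTerm t') := by
  have hrefl (l : List (STerm n)) : List.Forall₂ LDCong l l :=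
    List.forall₂_same.2 fun x _ => .refl x
  induction h with
  | LD t₁ t₂ t₃ =>
    simp only [JTerm, vstar, List.map_map, List.forall₂_map_left_iff,
      List.forall₂_map_right_iff]
    exact List.forall₂_same.2 fun x _ => LDCong.foldr_foldr _ _ x
  | ALD1 t₁ t₂ t₃ => simpa [JTerm, vstar] using fun x _ => LDCong.refl _
  | ALD2 t₁ t₂ t₃ => simpa only [JTerm, vstar, List.map_append] using hrefl _
  | refl t => exact hrefl _
  | symm _ ih => exact ih.flip.imp fun _ _ h => h.symm
  | trans _ _ ih₁ ih₂ =>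
    exact List.forall₂_iff_get.2 ⟨ih₁.length_eq.trans ih₂.length_eq, fun i h₁ h₂ =>
      (ih₁.get h₁ (ih₁.length_eq ▸ h₁)).trans (ih₂.get _ h₂)⟩
  | starCong _ _ ih₁ ih₂ =>
    simp only [JTerm, vstar, List.forall₂_map_left_iff, List.forall₂_map_right_iff]
    exact ih₂.imp fun _ _ hxy => LDCong.foldr_congr ih₁ hxy
  | circCong _ _ ih₁ ih₂ => exact List.rel_append ih₁ ih₂

/-- The inclusion of `*`-terms into terms over `*` and `∘`. -/
def STerm.toALDTerm {n : ℕ} : STerm n → ALDTerm n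
  | .var i => .var i
  | .star s t => .star s.toALDTerm t.toALDTerm

theorem LDCong.toALDTerm {n : ℕ} {s t : STerm n} (h : LDCong s t) :
    ALDCong s.toALDTerm t.toALDTerm := by
  induction h with
  | LD t₁ t₂ t₃ => exact .LD _ _ _
  | refl t => exact .refl _
  | symm _ ih => exact ih.symm
  | trans _ _ ih₁ ih₂ => exact ih₁.trans ih₂
  | starCong _ _ ih₁ ih₂ => exact ih₁.starCong ih₂

/-- `IsSubst c l u` says that `u` is obtained from the `∘`-term `c` by replacing its
variable occurrences, from left to right, by the entries of `l`. -/
inductive IsSubst {n : ℕ} : CTerm → List (STerm n) → ALDTerm n → Prop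
  | var (s : STerm n) : IsSubst .var [s] s.toALDTerm
  | circ {c d : CTerm} {l m : List (STerm n)} {u v : ALDTerm n} :
      IsSubst c l u → IsSubst d m v → IsSubst (.circ c d) (l ++ m) (.circ u v)

theorem IsSubst.length_eq {n : ℕ} {c : CTerm} {l m : List (STerm n)} {u v : ALDTerm n}
    (hu : IsSubst c l u) (hv : IsSubst c m v) : l.length = m.length := by
  induction hu generalizing m v with
  | var s => cases hv; rfl
  | circ _ _ ih₁ ih₂ =>
    cases hv with
    | circ h₁ h₂ => simp [ih₁ h₁, ih₂ h₂]

theorem IsSubst.congr {n : ℕ} {c : CTerm} {l m : List (STerm n)} {u v : ALDTerm n}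
    (hu : IsSubst c l u) (hv : IsSubst c m v) (h : List.Forall₂ LDCong l m) :
    ALDCong u v := by
  induction hu generalizing m v with
  | var s =>
    cases hv
    exact (List.forall₂_cons.1 h).1.toALDTerm
  | circ hc hd ih₁ ih₂ =>
    cases hv with
    | circ h₁ h₂ =>
      have hlen := hc.length_eq h₁
      refine (ih₁ h₁ ?_).circCong (ih₂ h₂ ?_)
      · simpa [← hlen] using List.forall₂_take_append _ _ _ h
      · simpa [← hlen] using List.forall₂_drop_append _ _ _ h

theorem IsSubst.star_toALDTerm {n : ℕ} {c : CTerm} {l : List (STerm n)} {u : ALDTerm n}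
    (hu : IsSubst c l u) (s : STerm n) :
    ALDCong (u.star s.toALDTerm) (l.foldr STerm.star s).toALDTerm := by
  induction hu generalizing s with
  | var a => exact .refl _
  | circ _ _ ih₁ ih₂ =>
    rw [List.foldr_append]
    exact (ALDCong.ALD1 _ _ _).trans (((ALDCong.refl _).starCong (ih₂ s)).trans (ih₁ _))

theorem IsSubst.exists_star {n : ℕ} {c d : CTerm} {l m : List (STerm n)} {u v : ALDTerm n}
    (hu : IsSubst c l u) (hv : IsSubst d m v) :
    ∃ w, IsSubst d (vstar l m) w ∧ ALDCong (u.star v) w := by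
  induction hv with
  | var s => exact ⟨_, .var _, hu.star_toALDTerm s⟩
  | circ _ _ ih₁ ih₂ =>
    obtain ⟨w₁, h₁, e₁⟩ := ih₁
    obtain ⟨w₂, h₂, e₂⟩ := ih₂
    refine ⟨w₁.circ w₂, ?_, (ALDCong.ALD2 _ _ _).trans (e₁.circCong e₂)⟩
    simpa only [vstar, List.map_append] using h₁.circ h₂

theorem ALDTerm.exists_isSubst {n : ℕ} (t : ALDTerm n) :
    ∃ u, IsSubst (ITerm t) (JTerm t) u ∧ ALDCong t u := by
  induction t with
  | var i => exact ⟨_, .var (.var i), .refl _⟩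
  | star t₁ t₂ ih₁ ih₂ =>
    obtain ⟨u₁, h₁, e₁⟩ := ih₁
    obtain ⟨u₂, h₂, e₂⟩ := ih₂
    obtain ⟨w, hw, e⟩ := h₁.exists_star h₂
    exact ⟨w, hw, (e₁.starCong e₂).trans e⟩
  | circ t₁ t₂ ih₁ ih₂ =>
    obtain ⟨u₁, h₁, e₁⟩ := ih₁
    obtain ⟨u₂, h₂, e₂⟩ := ih₂
    exact ⟨_, h₁.circ h₂, e₁.circCong e₂⟩

/-- two terms `t, t'` are ALD-equivalent if and only if `I(t) = I(t')`,
the sequences `J(t)` and `J(t')` have the same length, and their entries are pairwise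
LD-equivalent. This reduces the word problem of ALD to that of LD. -/
theorem ALD_iff_I_J {n : ℕ} (t t' : ALDTerm n) :
    ALDCong t t' ↔
      ITerm t = ITerm t' ∧
      (JTerm t).length = (JTerm t').length ∧
      ∀ (k : ℕ) (hk : k < (JTerm t).length) (hk' : k < (JTerm t').length),
        LDCong ((JTerm t).get ⟨k, hk⟩) ((JTerm t').get ⟨k, hk'⟩) := by
  constructor
  · intro h
    exact ⟨h.iTerm_eq, List.forall₂_iff_get.1 h.jTerm_forall₂⟩
  · rintro ⟨hI, hJ⟩
    obtain ⟨u, hu, e⟩ := t.exists_isSubst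
    obtain ⟨u', hu', e'⟩ := t'.exists_isSubst
    rw [← hI] at hu'
    exact e.trans ((hu.congr hu' (List.forall₂_iff_get.2 hJ)).trans e'.symm)
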